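/- Let f ∈ H²(𝔹) with f(0) ≠ 0, let n ∈ ℕ, and let p_n be the optimal approximant of degree n of f^{−*}. Then all the zeros of p_n lie outside the closed unit ball, i.e. every λ ∈ ℍ with p_n(λ) = 0 satisfies |λ| > 1. -/

import Mathlib

open MeasureTheory Filter Topology
open scoped ENNReal Classical

noncomputable section

/-! ### Basic quaternionic notions -/

instance : MeasurableSpace (Quaternion ℝ) := borel _
instance : BorelSpace (Quaternion ℝ) := ⟨rfl⟩

/-- The 2-sphere `𝕊` of quaternionic imaginary units. -/
def USphere : Set (Quaternion ℝ) := {q | q ^ 2 = -1}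

/-- The open quaternionic unit ball `𝔹`. -/
def QBall : Set (Quaternion ℝ) := {q | ‖q‖ < 1}

/-- The slice `L_I = ℝ + ℝI` through an imaginary unit `I`. -/
def sliceSet (I : Quaternion ℝ) : Set (Quaternion ℝ) :=
  {q | ∃ x y : ℝ, q = (x : Quaternion ℝ) + y • I}

/-- The point `e^{tI} = cos t + (sin t) I` of the boundary circle `∂𝔹_I`. -/
def ptOn (I : Quaternion ℝ) (t : ℝ) : Quaternion ℝ :=
  ((Real.cos t : ℝ) : Quaternion ℝ) + Real.sin t • I

/-- Slice regularity on the unit ball: on every slice the restriction of `f` has partial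
derivatives satisfying the Cauchy–Riemann equation `∂f/∂x + I ∂f/∂y = 0`. -/
def SliceRegular (f : Quaternion ℝ → Quaternion ℝ) : Prop :=
  ∀ I ∈ USphere, ∀ x y : ℝ, ((x : Quaternion ℝ) + y • I) ∈ QBall →
    ∃ fx fy : Quaternion ℝ,
      HasDerivAt (fun s : ℝ => f ((s : Quaternion ℝ) + y • I)) fx x ∧
      HasDerivAt (fun t : ℝ => f ((x : Quaternion ℝ) + t • I)) fy y ∧
      fx + I * fy = 0

/-! ### The Hardy space `H²(𝔹)` via power series coefficients.
A slice regular function on `𝔹` is identified with its coefficient sequence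
`a : ℕ → ℍ`, the function being `q ↦ ∑ qⁿ aₙ`. -/

/-- Membership in `H²(𝔹)`: square-summable coefficients. -/
def MemH2 (a : ℕ → Quaternion ℝ) : Prop := Summable (fun n => ‖a n‖ ^ 2)

/-- Evaluation of the power series `q ↦ ∑ qⁿ aₙ`. -/
def evalS (a : ℕ → Quaternion ℝ) (q : Quaternion ℝ) : Quaternion ℝ := ∑' n, q ^ n * a n

/-- The `*`-product (slice product) on coefficient sequences. -/
def sProd (a b : ℕ → Quaternion ℝ) : ℕ → Quaternion ℝ :=
  fun n => ∑ k ∈ Finset.range (n + 1), a k * b (n - k)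

/-- The regular conjugate `fᶜ`. -/
def conjS (a : ℕ → Quaternion ℝ) : ℕ → Quaternion ℝ := fun n => star (a n)

/-- The symmetrization `fˢ = f * fᶜ`. -/
def symmS (a : ℕ → Quaternion ℝ) : ℕ → Quaternion ℝ := sProd a (conjS a)

/-- The squared `H²` norm `∑ ‖aₙ‖²`. -/
def h2normSq (a : ℕ → Quaternion ℝ) : ℝ := ∑' n, ‖a n‖ ^ 2

/-- The `H²` norm. -/
def h2norm (a : ℕ → Quaternion ℝ) : ℝ := Real.sqrt (h2normSq a)

/-- The (right) quaternionic inner product `⟨f,g⟩ = ∑ conj(bₙ) aₙ` of `H²(𝔹)`. -/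
def h2inner (a b : ℕ → Quaternion ℝ) : Quaternion ℝ := ∑' n, star (b n) * a n

/-- Squared `H²`-distance of two coefficient sequences (valued in `ℝ≥0∞`). -/
def h2distSq (a b : ℕ → Quaternion ℝ) : ℝ≥0∞ := ∑' n, (‖a n - b n‖₊ : ℝ≥0∞) ^ 2

/-- The boundary value function of `f ∈ H²(𝔹)`, given by the radial limit where it exists. -/
def bdval (a : ℕ → Quaternion ℝ) (q : Quaternion ℝ) : Quaternion ℝ :=
  if h : ∃ L, Tendsto (fun r : ℝ => evalS a ((r : Quaternion ℝ) * q)) (𝓝[<] (1 : ℝ)) (𝓝 L)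
  then h.choose else 0

/-! ### The measure `Σ` on `∂𝔹` with `dΣ(e^{tI}) = dσ(I) dt`. -/

/-- The normalized area measure `σ` on the sphere `𝕊` of imaginary units
(2-dimensional Hausdorff measure, normalized so that `σ(𝕊) = 1`). -/
def sphMeasure : Measure (Quaternion ℝ) := (μH[2] USphere)⁻¹ • (μH[2]).restrict USphere

/-- The measure `Σ` on `∂𝔹`, `dΣ(e^{tI}) = dσ(I) dt`, normalized so `Σ(∂𝔹) = 1`. -/
def SigmaBd : Measure (Quaternion ℝ) :=
  (ENNReal.ofReal (2 * Real.pi))⁻¹ •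
    Measure.map (fun p : ℝ × Quaternion ℝ => ptOn p.2 p.1)
      ((volume.restrict (Set.Ico 0 (2 * Real.pi))).prod sphMeasure)

/-! ### Inner, outer, cyclic -/

/-- `f ∈ H^∞(𝔹)`: a bounded function of `H²(𝔹)`. -/
def MemHinf (a : ℕ → Quaternion ℝ) : Prop :=
  MemH2 a ∧ ∃ C : ℝ, ∀ q ∈ QBall, ‖evalS a q‖ ≤ C

/-- The `H^∞` norm: the sup of `‖f‖` on the ball. -/
def hInfNorm (a : ℕ → Quaternion ℝ) : ℝ := sSup ((fun q => ‖evalS a q‖) '' QBall)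

/-- `f` is inner: `f ∈ H^∞(𝔹)`, `‖f‖ ≤ 1` on `𝔹` and `‖f‖ = 1` `Σ`-a.e. on `∂𝔹`. -/
def IsInnerQ (a : ℕ → Quaternion ℝ) : Prop :=
  MemH2 a ∧ (∀ q ∈ QBall, ‖evalS a q‖ ≤ 1) ∧ (∀ᵐ q ∂SigmaBd, ‖bdval a q‖ = 1)

/-- `g` is outer: whenever `f ∈ H²(𝔹)` has the same boundary modulus `Σ`-a.e.,
then `‖g‖ ≥ ‖f‖` throughout `𝔹`. -/
def IsOuterQ (g : ℕ → Quaternion ℝ) : Prop :=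
  MemH2 g ∧ ∀ f, MemH2 f → (∀ᵐ q ∂SigmaBd, ‖bdval g q‖ = ‖bdval f q‖) →
    ∀ q ∈ QBall, ‖evalS f q‖ ≤ ‖evalS g q‖

/-- Quaternionic polynomials (finitely supported coefficient sequences). -/
def IsPolyQ (p : ℕ → Quaternion ℝ) : Prop := ∃ N, ∀ n > N, p n = 0

/-- Quaternionic polynomials of degree at most `n` (the space `𝒫_n`). -/
def IsPolyDeg (p : ℕ → Quaternion ℝ) (n : ℕ) : Prop := ∀ m > n, p m = 0

/-- The coefficient sequence of the monomial `qᵏ`. -/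
def qpow (k : ℕ) : ℕ → Quaternion ℝ := fun n => if n = k then 1 else 0

/-- The coefficient sequence of a constant function. -/
def constS (c : Quaternion ℝ) : ℕ → Quaternion ℝ := fun n => if n = 0 then c else 0

/-- The coefficient sequence of the constant function `1`. -/
def oneS : ℕ → Quaternion ℝ := constS 1

/-- The invariant subspace `[g]`: the `H²`-closure of `{g * p : p polynomial}`,
i.e. of the right span of `{qⁿ * g : n ≥ 0}`. -/
def InvSub (g : ℕ → Quaternion ℝ) : Set (ℕ → Quaternion ℝ) :=
  {h | MemH2 h ∧ ∀ ε : ℝ≥0∞, 0 < ε → ∃ p, IsPolyQ p ∧ h2distSq (sProd g p) h < ε}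

/-- `g` is cyclic: `[g] = H²(𝔹)`. -/
def IsCyclicQ (g : ℕ → Quaternion ℝ) : Prop :=
  MemH2 g ∧ ∀ h, MemH2 h → h ∈ InvSub g

/-! ### Bilateral (slice `L²`) series, used for boundary products -/

/-- Bilateral coefficients of `f̃(q) = f(q̄)` on `∂𝔹`: `Σ_{n ≤ 0} qⁿ a_{-n}`. -/
def tildeZ (a : ℕ → Quaternion ℝ) : ℤ → Quaternion ℝ :=
  fun k => if k ≤ 0 then a (-k).toNat else 0

/-- Bilateral coefficients of `fᶜ` on `∂𝔹`. -/
def conjZ (a : ℕ → Quaternion ℝ) : ℤ → Quaternion ℝ :=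
  fun k => if 0 ≤ k then star (a k.toNat) else 0

/-- The `*`-product of two slice `L²` functions on the boundary, on coefficients. -/
def convZ (c b : ℤ → Quaternion ℝ) : ℤ → Quaternion ℝ := fun n => ∑' k : ℤ, c k * b (n - k)

/-- Evaluation of a bilateral series `q ↦ ∑_{n ∈ ℤ} qⁿ dₙ`. -/
def evalZ (d : ℤ → Quaternion ℝ) (q : Quaternion ℝ) : Quaternion ℝ := ∑' n : ℤ, q ^ n * d n

/-- The slice inner product `⟨qᵏ * f, f⟩_I = (1/2π)∫₀^{2π} conj(f(e^{θI})) (e^{θI})ᵏ f(e^{θI}) dθ`,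
computed with boundary values; note `(qᵏ * f)(q) = qᵏ f(q)` pointwise. -/
def sliceInnerPow (a : ℕ → Quaternion ℝ) (I : Quaternion ℝ) (k : ℕ) : Quaternion ℝ :=
  (2 * Real.pi)⁻¹ •
    ∫ t in Set.Ico 0 (2 * Real.pi), star (bdval a (ptOn I t)) * ((ptOn I t) ^ k * bdval a (ptOn I t))

/-! ### Complex Hardy space `H²(𝔻)` notions (for slice restrictions) -/

/-- Membership in the complex Hardy space `H²(𝔻)` via coefficients. -/
def CMemH2 (c : ℕ → ℂ) : Prop := Summable (fun n => ‖c n‖ ^ 2)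

/-- Evaluation of a complex power series. -/
def cEval (c : ℕ → ℂ) (z : ℂ) : ℂ := ∑' n, z ^ n * c n

/-- Cauchy product of complex coefficient sequences. -/
def cConv (c d : ℕ → ℂ) : ℕ → ℂ := fun n => ∑ k ∈ Finset.range (n + 1), c k * d (n - k)

/-- Squared `H²(𝔻)` distance. -/
def cDistSq (c d : ℕ → ℂ) : ℝ≥0∞ := ∑' n, (‖c n - d n‖₊ : ℝ≥0∞) ^ 2

/-- Radial boundary values of a complex `H²` function. -/
def cBdval (c : ℕ → ℂ) (z : ℂ) : ℂ :=
  if h : ∃ L, Tendsto (fun r : ℝ => cEval c ((r : ℂ) * z)) (𝓝[<] (1 : ℝ)) (𝓝 L)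
  then h.choose else 0

/-- Lebesgue measure on the unit circle `∂𝔻` (parametrized by `θ ∈ [0, 2π)`). -/
def circleM : Measure ℂ :=
  Measure.map (fun t : ℝ => Complex.exp (t * Complex.I)) (volume.restrict (Set.Ico 0 (2 * Real.pi)))

/-- Cyclicity in `H²(𝔻)`: polynomial multiples of `c` are dense. -/
def CIsCyclic (c : ℕ → ℂ) : Prop :=
  CMemH2 c ∧ ∀ h, CMemH2 h → ∀ ε : ℝ≥0∞, 0 < ε →
    ∃ p : ℕ → ℂ, (∃ N, ∀ n > N, p n = 0) ∧ cDistSq (cConv c p) h < ε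

/-- Outerness in `H²(𝔻)` (in the sense matching Definition 2.10 of the paper). -/
def CIsOuter (c : ℕ → ℂ) : Prop :=
  CMemH2 c ∧ ∀ h, CMemH2 h →
    (∀ᵐ z ∂circleM, ‖cBdval c z‖ = ‖cBdval h z‖) →
    ∀ z ∈ Metric.ball (0 : ℂ) 1, ‖cEval h z‖ ≤ ‖cEval c z‖

/-- Complex coordinates of a point of the slice `L_I`: if `p = x + yI` then
`sliceToC I p = x + iy`. -/
def sliceToC (I : Quaternion ℝ) (p : Quaternion ℝ) : ℂ := ⟨p.re, -(p * I).re⟩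

/-- The quaternion `i`. -/
def qI : Quaternion ℝ := ⟨0, 1, 0, 0⟩

/-- The embedding of `ℂ = L_i` into the quaternions. -/
def cToQ (z : ℂ) : Quaternion ℝ := (z.re : Quaternion ℝ) + z.im • qI

/-- The imaginary unit `I_ω` identified by `ω` (any imaginary unit if `ω` is real). -/
def Iu (ω : Quaternion ℝ) : Quaternion ℝ := if ω.im = 0 then qI else ‖ω.im‖⁻¹ • ω.im

/-! ### Optimal approximants -/

/-- `p` is an optimal approximant of degree `n` of `f^{-*}`: `p ∈ 𝒫_n` minimizes
`‖f * p - 1‖_{H²}` among all `p ∈ 𝒫_n`. -/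
def IsOptApprox (a : ℕ → Quaternion ℝ) (n : ℕ) (p : ℕ → Quaternion ℝ) : Prop :=
  IsPolyDeg p n ∧ ∀ r, IsPolyDeg r n → h2distSq (sProd a p) oneS ≤ h2distSq (sProd a r) oneS

end
noncomputable section

/-! ### Helper lemmas -/

theorem aux_orth {E : Type*} [NormedAddCommGroup E] [InnerProductSpace ℝ E] (x y : E)
    (h : ∀ t : ℝ, ‖x‖ ^ 2 ≤ ‖x + t • y‖ ^ 2) : inner ℝ x y = 0 := by
  set b := inner ℝ x y with hb
  have h1 : ∀ t : ℝ, 0 ≤ 2 * (t * b) + t ^ 2 * ‖y‖ ^ 2 := by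
    intro t
    have h2 := h t
    rw [norm_add_sq_real, inner_smul_right, norm_smul, mul_pow, Real.norm_eq_abs, sq_abs] at h2
    linarith
  set c := ‖y‖ ^ 2 with hc
  have hc0 : 0 ≤ c := by positivity
  have h3 := h1 (-b / (c + 1))
  have h4 : 2 * (-b / (c + 1) * b) + (-b / (c + 1)) ^ 2 * c
      = -(b ^ 2 * (c + 2)) / (c + 1) ^ 2 := by
    field_simp
    ring
  rw [h4] at h3
  have h5 : 0 ≤ -(b ^ 2 * (c + 2)) := by
    by_contra hneg
    push Not at hneg
    have : -(b ^ 2 * (c + 2)) / (c + 1) ^ 2 < 0 := div_neg_of_neg_of_pos hneg (by positivity)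
    linarith
  have h6 : b ^ 2 ≤ 0 := by nlinarith [sq_nonneg b]
  exact pow_eq_zero_iff (two_ne_zero) |>.1 (le_antisymm h6 (sq_nonneg b))

theorem MemH2.memlp {u : ℕ → Quaternion ℝ} (h : MemH2 u) :
    Memℓp (E := fun _ : ℕ => Quaternion ℝ) u 2 := by
  apply memℓp_gen
  simpa [MemH2] using h

theorem Memlp.memH2 {u : ℕ → Quaternion ℝ}
    (h : Memℓp (E := fun _ : ℕ => Quaternion ℝ) u 2) : MemH2 u := by
  have := (memℓp_gen_iff (by norm_num)).1 h
  simpa [MemH2] using this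

/-- The element of `ℓ²` attached to a sequence in `H²`. -/
def toL (u : ℕ → Quaternion ℝ) (h : MemH2 u) : lp (fun _ : ℕ => Quaternion ℝ) 2 := ⟨u, h.memlp⟩

theorem toL_apply (u : ℕ → Quaternion ℝ) (h : MemH2 u) (n : ℕ) : toL u h n = u n := rfl

theorem lp_norm_sq (x : lp (fun _ : ℕ => Quaternion ℝ) 2) : ‖x‖ ^ 2 = ∑' n, ‖x n‖ ^ 2 := by
  have := lp.norm_rpow_eq_tsum (p := 2) (by norm_num) x
  simpa using this

theorem h2distSq_eq (u v : ℕ → Quaternion ℝ) (hu : MemH2 u) (hv : MemH2 v) :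
    h2distSq u v = ENNReal.ofReal (‖toL u hu - toL v hv‖ ^ 2) := by
  have hs : Summable (fun n => ‖(toL u hu - toL v hv) n‖ ^ 2) :=
    Memlp.memH2 (toL u hu - toL v hv).2
  rw [lp_norm_sq, ENNReal.ofReal_tsum_of_nonneg (fun n => by positivity) hs]
  unfold h2distSq
  congr 1
  ext1 n
  rw [ENNReal.ofReal_pow (norm_nonneg _), ofReal_norm]
  rfl

/-- Multiplication by `q`. -/
def shiftS (g : ℕ → Quaternion ℝ) : ℕ → Quaternion ℝ
  | 0 => 0
  | (k + 1) => g k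

theorem MemH2.shiftS {g : ℕ → Quaternion ℝ} (h : MemH2 g) : MemH2 (shiftS g) := by
  unfold MemH2
  rw [← summable_nat_add_iff 1]
  exact h

theorem MemH2.mul_right {g : ℕ → Quaternion ℝ} (h : MemH2 g) (c : Quaternion ℝ) :
    MemH2 (fun k => g k * c) := by
  have := Summable.mul_right (‖c‖ ^ 2) h
  unfold MemH2
  simpa [norm_mul, mul_pow] using this

theorem MemH2.add {f g : ℕ → Quaternion ℝ} (hf : MemH2 f) (hg : MemH2 g) :
    MemH2 (fun k => f k + g k) :=
  Memlp.memH2 (hf.memlp.add hg.memlp)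

theorem sProd_shiftS (a g : ℕ → Quaternion ℝ) : sProd a (shiftS g) = shiftS (sProd a g) := by
  funext m
  cases m with
  | zero => simp [sProd, shiftS]
  | succ m =>
    simp only [sProd, shiftS]
    rw [Finset.sum_range_succ]
    simp only [Nat.sub_self, mul_zero, add_zero]
    apply Finset.sum_congr rfl
    intro k hk
    have : m + 1 - k = (m - k) + 1 := by
      have := Finset.mem_range.1 hk
      omega
    rw [this]

theorem sProd_add (a f g : ℕ → Quaternion ℝ) :
    sProd a (fun k => f k + g k) = fun k => sProd a f k + sProd a g k := by
  funext m
  simp [sProd, mul_add, Finset.sum_add_distrib]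

theorem sProd_mul_right (a g : ℕ → Quaternion ℝ) (c : Quaternion ℝ) :
    sProd a (fun k => g k * c) = fun k => sProd a g k * c := by
  funext m
  simp [sProd, Finset.sum_mul, mul_assoc]

theorem sProd_constS (a : ℕ → Quaternion ℝ) (c : Quaternion ℝ) :
    sProd a (constS c) = fun k => a k * c := by
  funext m
  simp only [sProd, constS]
  rw [Finset.sum_range_succ, Finset.sum_eq_zero]
  · simp
  · intro k hk
    have := Finset.mem_range.1 hk
    rw [if_neg (by omega), mul_zero]

theorem memH2_sProd (a : ℕ → Quaternion ℝ) (ha : MemH2 a) (n : ℕ) :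
    ∀ r, IsPolyDeg r n → MemH2 (sProd a r) := by
  induction n with
  | zero =>
    intro r hr
    have : r = constS (r 0) := by
      funext m
      cases m with
      | zero => simp [constS]
      | succ m => simp [constS, hr (m + 1) (by omega)]
    rw [this, sProd_constS]
    exact ha.mul_right _
  | succ n ih =>
    intro r hr
    have : r = fun k => shiftS (fun k => r (k + 1)) k + constS (r 0) k := by
      funext m
      cases m with
      | zero => simp [constS, shiftS]
      | succ m => simp [constS, shiftS]
    rw [this, sProd_add, sProd_shiftS, sProd_constS]
    refine (MemH2.shiftS (ih _ ?_)).add (ha.mul_right _)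
    intro m hm
    exact hr _ (by omega)

theorem memH2_oneS : MemH2 oneS := by
  apply summable_of_ne_finset_zero (s := {0})
  intro b hb
  have : b ≠ 0 := by simpa using hb
  simp [oneS, constS, this]

theorem quat_sq (l : Quaternion ℝ) : l * l = (2 * l.re) • l - ((‖l‖ ^ 2 : ℝ) : Quaternion ℝ) := by
  have h1 : l + star l = ((2 * l.re : ℝ) : Quaternion ℝ) := by
    simpa using Quaternion.self_add_star' l
  have h2 : l * star l = ((‖l‖ ^ 2 : ℝ) : Quaternion ℝ) := by
    rw [Quaternion.self_mul_star, Quaternion.normSq_eq_norm_mul_self, sq]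
  have h3 : star l = ((2 * l.re : ℝ) : Quaternion ℝ) - l := by rw [← h1]; abel
  rw [h3, mul_sub, Quaternion.mul_coe_eq_smul] at h2
  rw [← h2]
  abel

theorem quat_pow (l : Quaternion ℝ) : ∀ n : ℕ, ∃ α β : ℝ,
    l ^ n = α • l + (β : Quaternion ℝ) := by
  intro n
  induction n with
  | zero => exact ⟨0, 1, by simp⟩
  | succ n ih =>
    obtain ⟨α, β, h⟩ := ih
    refine ⟨α * (2 * l.re) + β, -(α * ‖l‖ ^ 2), ?_⟩
    rw [pow_succ, h, add_mul, smul_mul_assoc, quat_sq, Quaternion.coe_mul_eq_smul, smul_sub,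
      smul_smul, add_smul, Quaternion.coe_neg, Quaternion.coe_mul, Quaternion.coe_mul_eq_smul]
    abel

/-- A left zero gives a right zero of the same norm. -/
theorem exists_right_zero (p : ℕ → Quaternion ℝ) (N : ℕ) (l : Quaternion ℝ)
    (h : ∑ k ∈ Finset.range N, l ^ k * p k = 0) :
    ∃ μ : Quaternion ℝ, ‖μ‖ = ‖l‖ ∧ ∑ k ∈ Finset.range N, p k * μ ^ k = 0 := by
  choose α β hαβ using quat_pow l
  set A := ∑ k ∈ Finset.range N, α k • p k with hA
  set B := ∑ k ∈ Finset.range N, β k • p k with hB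
  have hl : l * A + B = 0 := by
    rw [← h, hA, hB, Finset.mul_sum, ← Finset.sum_add_distrib]
    apply Finset.sum_congr rfl
    intro k _
    rw [hαβ k, add_mul, Quaternion.coe_mul_eq_smul, mul_smul_comm, smul_mul_assoc]
  have key : ∀ μ : Quaternion ℝ, (∀ k, μ ^ k = α k • μ + (β k : Quaternion ℝ)) →
      ∑ k ∈ Finset.range N, p k * μ ^ k = A * μ + B := by
    intro μ hμ
    rw [hA, hB, Finset.sum_mul, ← Finset.sum_add_distrib]
    apply Finset.sum_congr rfl
    intro k _
    rw [hμ k, mul_add, Quaternion.mul_coe_eq_smul, mul_smul_comm, smul_mul_assoc]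
  by_cases hA0 : A = 0
  · refine ⟨l, rfl, ?_⟩
    rw [key l hαβ]
    rw [hA0] at hl ⊢
    simpa using hl
  · refine ⟨A⁻¹ * l * A, ?_, ?_⟩
    · rw [norm_mul, norm_mul, norm_inv]
      have : ‖A‖ ≠ 0 := norm_ne_zero_iff.2 hA0
      field_simp
    · rw [key]
      · rw [← mul_assoc, ← mul_assoc, mul_inv_cancel₀ hA0, one_mul, hl]
      · intro k
        have h1 : (A⁻¹ * l * A) ^ k = A⁻¹ * l ^ k * A := by
          induction k with
          | zero => simp [inv_mul_cancel₀ hA0]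
          | succ k ih =>
            rw [pow_succ, ih, pow_succ]
            simp only [mul_assoc]
            rw [mul_inv_cancel_left₀ hA0]
        rw [h1, hαβ k, mul_add, add_mul, mul_smul_comm, smul_mul_assoc,
          Quaternion.mul_coe_eq_smul, smul_mul_assoc, inv_mul_cancel₀ hA0]
        congr 1
        rw [← Quaternion.coe_mul_eq_smul, mul_one]

/-- Division by `q - μ` on the right. -/
theorem exists_factor (p : ℕ → Quaternion ℝ) (n : ℕ) (hp : IsPolyDeg p n) (μ : Quaternion ℝ)
    (h : ∑ k ∈ Finset.range (n + 1), p k * μ ^ k = 0) :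
    ∃ g : ℕ → Quaternion ℝ, IsPolyDeg (shiftS g) n ∧
      shiftS g = fun k => p k + g k * μ := by
  refine ⟨fun k => ∑ j ∈ Finset.range n, p (k + 1 + j) * μ ^ j, ?_, ?_⟩
  · intro m hm
    cases m with
    | zero => omega
    | succ m =>
      apply Finset.sum_eq_zero
      intro j _
      rw [hp _ (by omega), zero_mul]
  · funext m
    cases m with
    | zero =>
      rw [Finset.sum_range_succ'] at h
      simp only [shiftS, Finset.sum_mul, mul_assoc, ← pow_succ]
      rw [← h, add_comm]
      simp [add_comm]
    | succ m =>
      simp only [shiftS, Finset.sum_mul, mul_assoc, ← pow_succ]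
      have h1 := Finset.sum_range_succ (fun j => p (m + 1 + j) * μ ^ j) n
      have h2 := Finset.sum_range_succ' (fun j => p (m + 1 + j) * μ ^ j) n
      rw [h1, hp (m + 1 + n) (by omega), zero_mul, add_zero] at h2
      rw [h2, add_comm]
      simp only [pow_zero, mul_one, add_zero]
      congr 1
      apply Finset.sum_congr rfl
      intro j _
      congr 2
      omega

end

/-- If `f ∈ H²(𝔹)` with `f(0) ≠ 0` and `p` is the optimal approximant of degree `n` of
`f^{-*}`, then every zero of `p` lies outside the closed unit ball. -/
theorem opt_approx_zeros_outside (a : ℕ → Quaternion ℝ) (ha : MemH2 a)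
    (h0 : evalS a 0 ≠ 0) (n : ℕ) (p : ℕ → Quaternion ℝ) (hp : IsOptApprox a n p) :
    ∀ l : Quaternion ℝ, evalS p l = 0 → 1 < ‖l‖ := by
  intro l hl
  obtain ⟨hpd, hopt⟩ := hp
  have ha0 : a 0 ≠ 0 := by
    have : evalS a 0 = a 0 := by
      unfold evalS
      rw [tsum_eq_single 0]
      · simp
      · intro b hb
        simp [hb]
    rwa [this] at h0
  have hl' : ∑ k ∈ Finset.range (n + 1), l ^ k * p k = 0 := by
    rw [← hl]
    unfold evalS
    symm
    apply tsum_eq_sum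
    intro b hb
    have : n < b := by simpa using hb
    rw [hpd b this, mul_zero]
  obtain ⟨μ, hμ, hμ0⟩ := exists_right_zero p (n + 1) l hl'
  obtain ⟨g, hgd, hg⟩ := exists_factor p n hpd μ hμ0
  have hP := memH2_sProd a ha n p hpd
  set P := toL _ hP with hPdef
  set O := toL _ memH2_oneS with hOdef
  -- orthogonality
  have orth : ∀ s (hs : IsPolyDeg s n), inner ℝ (P - O) (toL _ (memH2_sProd a ha n s hs)) = 0 := by
    intro s hs
    apply aux_orth
    intro t
    have hr : IsPolyDeg (fun k => p k + s k * (t : Quaternion ℝ)) n := by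
      intro m hm
      simp [hpd m hm, hs m hm]
    have h1 := hopt _ hr
    have hR := memH2_sProd a ha n _ hr
    rw [h2distSq_eq _ _ hP memH2_oneS, h2distSq_eq _ _ hR memH2_oneS,
      ENNReal.ofReal_le_ofReal_iff (by positivity)] at h1
    have h2 : toL _ hR = P + t • toL _ (memH2_sProd a ha n s hs) := by
      apply lp.ext
      funext m
      rw [lp.coeFn_add, Pi.add_apply, lp.coeFn_smul, Pi.smul_apply, hPdef, toL_apply, toL_apply,
        toL_apply, sProd_add, sProd_mul_right]
      simp only [Quaternion.mul_coe_eq_smul]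
    rw [h2] at h1
    have h3 : P - O + t • toL _ (memH2_sProd a ha n s hs)
        = P + t • toL _ (memH2_sProd a ha n s hs) - O := by abel
    rw [h3]
    exact h1
  have innerO : ∀ x : lp (fun _ : ℕ => Quaternion ℝ) 2, inner ℝ O x = inner ℝ (1 : Quaternion ℝ) (x 0) := by
    intro x
    rw [lp.inner_eq_tsum, tsum_eq_single 0]
    · rw [hOdef, toL_apply]
      simp [oneS, constS]
    · intro b hb
      rw [hOdef, toL_apply]
      simp [oneS, constS, hb]
  -- `f * p ≠ 0`
  have hPne : P ≠ 0 := by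
    intro hP0
    have hc : IsPolyDeg (constS (star (a 0))) n := by
      intro m hm
      simp [constS, show m ≠ 0 by omega]
    have h1 := orth _ hc
    rw [hP0, zero_sub, inner_neg_left, innerO, toL_apply, sProd_constS] at h1
    beta_reduce at h1
    rw [Quaternion.self_mul_star, Quaternion.inner_def, Quaternion.star_coe, one_mul, Quaternion.re_coe, neg_eq_zero,
      Quaternion.normSq_eq_zero] at h1
    exact ha0 h1
  have hQ := memH2_sProd a ha n _ hgd
  set Q := toL _ hQ with hQdef
  have hPQ : inner ℝ P Q = 0 := by
    have h1 := orth _ hgd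
    have h2 : Q 0 = 0 := by
      rw [hQdef, toL_apply, sProd_shiftS]
      rfl
    rw [← hQdef, inner_sub_left, innerO, h2, inner_zero_right, sub_zero] at h1
    exact h1
  have hGd : IsPolyDeg g n := fun m hm => hgd (m + 1) (by omega)
  have hG := memH2_sProd a ha n _ hGd
  have hGμ := hG.mul_right μ
  have hQP : Q = P + toL _ hGμ := by
    apply lp.ext
    funext m
    change sProd a _ m = sProd a p m + sProd a g m * μ
    rw [hg, sProd_add, sProd_mul_right]
  have hnQ : ‖Q‖ ^ 2 = ‖toL _ hG‖ ^ 2 := by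
    have hs : Summable (fun n => ‖Q n‖ ^ 2) := hQ
    rw [lp_norm_sq, lp_norm_sq, hs.tsum_eq_zero_add]
    simp [hQdef, toL_apply, sProd_shiftS, shiftS]
  have hnG : ‖toL _ hGμ‖ ^ 2 = ‖toL _ hG‖ ^ 2 * ‖μ‖ ^ 2 := by
    rw [lp_norm_sq, lp_norm_sq, ← tsum_mul_right]
    simp [toL_apply, mul_pow]
  have h3 : toL _ hGμ = Q - P := by rw [hQP]; abel
  have h4 : ‖toL _ hGμ‖ ^ 2 = ‖Q‖ ^ 2 + ‖P‖ ^ 2 := by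
    rw [h3, norm_sub_sq_real, real_inner_comm, hPQ]
    ring
  have h5 : 0 < ‖P‖ := norm_pos_iff.2 hPne
  rw [hnG, hnQ] at h4
  rw [← hμ]
  by_contra hle
  push Not at hle
  have h6 : ‖μ‖ ^ 2 ≤ 1 := pow_le_one₀ (norm_nonneg _) hle
  nlinarith [sq_nonneg ‖toL _ hG‖, sq_pos_of_pos h5]
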